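/- Let κ be a positive integer and n ∈ ℤ. The function θ_{κ,n} satisfies the heat equation 2πiκ · ∂θ_{κ,n}/∂τ (λ,τ) = ∂²θ_{κ,n}/∂λ² (λ,τ) for all λ ∈ ℂ and all τ in the upper half-plane. -/

import Mathlib

open Complex

/-- The complex number π. -/
noncomputable def cπ : ℂ := Real.pi

/-- The first Jacobi theta function
`ϑ₁(λ,τ) = 2 q^{1/8} sin(πλ) ∏_{j≥1} (1-q^j e^{2πiλ})(1-q^j e^{-2πiλ})(1-q^j)`, `q = e^{2πiτ}`. -/
noncomputable def JTheta1 (z τ : ℂ) : ℂ :=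
  2 * exp (cπ * I * τ / 4) * sin (cπ * z) *
    ∏' n : ℕ, ((1 - exp (2 * cπ * I * τ) ^ (n + 1) * exp (2 * cπ * I * z)) *
      (1 - exp (2 * cπ * I * τ) ^ (n + 1) * exp (-(2 * cπ * I * z))) *
      (1 - exp (2 * cπ * I * τ) ^ (n + 1)))

/-- The Dedekind eta function `η(τ) = q^{1/24} ∏_{j≥1} (1-q^j)`, `q = e^{2πiτ}`. -/
noncomputable def DEta (τ : ℂ) : ℂ :=
  exp (cπ * I * τ / 12) * ∏' n : ℕ, (1 - exp (2 * cπ * I * τ) ^ (n + 1))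

/-- The theta function of level κ:
`θ_{κ,n}(λ,τ) = Σ_{j∈ℤ} exp(2πiκ(j+n/(2κ))²τ + 2πiκ(j+n/(2κ))λ)`. -/
noncomputable def ThetaKN (κ : ℕ) (n : ℤ) (z τ : ℂ) : ℂ :=
  ∑' j : ℤ, exp (2 * cπ * I * (κ : ℂ) * ((j : ℂ) + (n : ℂ) / (2 * (κ : ℂ))) ^ 2 * τ +
    2 * cπ * I * (κ : ℂ) * ((j : ℂ) + (n : ℂ) / (2 * (κ : ℂ))) * z)

/-- The symmetrization `θ^s_{κ,n}(λ,τ) = θ_{κ,n}(λ,τ) + θ_{κ,n}(-λ,τ)`. -/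
noncomputable def ThetaS (κ : ℕ) (n : ℤ) (z τ : ℂ) : ℂ :=
  ThetaKN κ n z τ + ThetaKN κ n (-z) τ

/-- `ρ(λ,τ) = ϑ₁'(λ,τ)/ϑ₁(λ,τ)` (derivative in the first argument). -/
noncomputable def Rho (z τ : ℂ) : ℂ :=
  deriv (fun w => JTheta1 w τ) z / JTheta1 z τ

/-- `ρ'(λ,τ)`, the derivative of `ρ` in the first argument. -/
noncomputable def Rho' (z τ : ℂ) : ℂ := deriv (fun w => Rho w τ) z

/-- `u` satisfies the KZB heat equation with parameters `κ`, `p` at `(λ,τ)`: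
`2πiκ ∂u/∂τ = ∂²u/∂λ² + p(p+1)ρ'(λ,τ)u`. -/
def KZB (κ p : ℕ) (u : ℂ → ℂ → ℂ) (z τ : ℂ) : Prop :=
  2 * cπ * I * (κ : ℂ) * deriv (fun t => u z t) τ =
    iteratedDeriv 2 (fun w => u w τ) z + (p : ℂ) * ((p : ℂ) + 1) * Rho' z τ * u z τ


lemma hasSum_derivs_aux {f : ℤ → ℂ → ℂ} {u : ℤ → ℝ} (hu : Summable u)
    (hf : ∀ j, Differentiable ℂ (f j)) {z : ℂ}
    (hb : ∀ᶠ w in nhds z, ∀ j, ‖f j w‖ ≤ u j) :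
    HasSum (fun j => deriv (f j) z) (deriv (fun w => ∑' j, f j w) z) ∧
    HasSum (fun j => deriv (deriv (f j)) z) (deriv (deriv (fun w => ∑' j, f j w)) z) := by
  obtain ⟨U, hUb, hU, hz⟩ := eventually_nhds_iff.1 hb
  have h0 : TendstoLocallyUniformlyOn (fun s : Finset ℤ => fun w => ∑ j ∈ s, f j w)
      (fun w => ∑' j, f j w) Filter.atTop U :=
    (tendstoUniformlyOn_tsum hu fun j w hw => hUb w hw j).tendstoLocallyUniformlyOn
  have hd : ∀ j, Differentiable ℂ (deriv (f j)) := fun j =>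
    differentiableOn_univ.1 ((hf j).differentiableOn.deriv isOpen_univ)
  have e1 : ∀ s : Finset ℤ, deriv (fun w => ∑ j ∈ s, f j w) = fun w => ∑ j ∈ s, deriv (f j) w := by
    intro s; ext w
    exact deriv_fun_sum fun j _ => (hf j) w
  have e2 : ∀ s : Finset ℤ, deriv (fun w => ∑ j ∈ s, deriv (f j) w) =
      fun w => ∑ j ∈ s, deriv (deriv (f j)) w := by
    intro s; ext w
    exact deriv_fun_sum fun j _ => (hd j) w
  have h1 := h0.deriv (.of_forall fun s =>
    (Differentiable.fun_sum fun j _ => hf j).differentiableOn) hU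
  have h1' : TendstoLocallyUniformlyOn (fun s : Finset ℤ => fun w => ∑ j ∈ s, deriv (f j) w)
      (deriv fun w => ∑' j, f j w) Filter.atTop U := by
    simpa only [Function.comp_def, e1] using h1
  have h2 := h1'.deriv (.of_forall fun s =>
    (Differentiable.fun_sum fun j _ => hd j).differentiableOn) hU
  simp only [Function.comp_def, e2] at h2
  exact ⟨h1'.tendsto_at hz, h2.tendsto_at hz⟩

lemma theta_bound_aux (κ : ℕ) (hκ : 0 < κ) (n : ℤ) (z τ : ℂ) (hτ : 0 < τ.im) :
    ∃ u : ℤ → ℝ, Summable u ∧ ∀ᶠ p : ℂ × ℂ in nhds (z, τ), ∀ j : ℤ,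
      ‖exp (2 * cπ * I * (κ : ℂ) * ((j : ℂ) + (n : ℂ) / (2 * (κ : ℂ))) ^ 2 * p.2 +
    2 * cπ * I * (κ : ℂ) * ((j : ℂ) + (n : ℂ) / (2 * (κ : ℂ))) * p.1)‖ ≤ u j := by
  have hκ' : (κ : ℂ) ≠ 0 := by exact_mod_cast hκ.ne'
  have hκr : (0 : ℝ) < κ := by exact_mod_cast hκ
  let C : ℂ × ℂ → ℂ := fun p => cπ * I * n ^ 2 / (2 * κ) * p.2 + cπ * I * n * p.1
  let A : ℂ × ℂ → ℂ := fun p => n * p.2 + κ * p.1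
  let B : ℂ × ℂ → ℂ := fun p => ((2 * κ : ℝ) : ℂ) * p.2
  have key : ∀ (p : ℂ × ℂ) (j : ℤ),
      exp (2 * cπ * I * (κ : ℂ) * ((j : ℂ) + (n : ℂ) / (2 * (κ : ℂ))) ^ 2 * p.2 +
        2 * cπ * I * (κ : ℂ) * ((j : ℂ) + (n : ℂ) / (2 * (κ : ℂ))) * p.1) =
      exp (C p) * jacobiTheta₂_term j (A p) (B p) := by
    intro p j
    rw [jacobiTheta₂_term, ← Complex.exp_add]
    congr 1
    simp only [C, A, B, cπ]
    push_cast
    field_simp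
    ring
  have hT : 0 < κ * τ.im := by positivity
  have hB : κ * τ.im < (B (z, τ)).im := by
    simp only [B, Complex.im_ofReal_mul]; nlinarith
  have c1 : Continuous fun p => ‖exp (C p)‖ := by fun_prop
  have c2 : Continuous fun p => |(A p).im| :=
    (Complex.continuous_im.comp (by fun_prop : Continuous A)).abs
  have c3 : Continuous fun p => (B p).im := Complex.continuous_im.comp (by fun_prop : Continuous B)
  refine ⟨fun j => (‖exp (C (z, τ))‖ + 1) *
    (|j| ^ 0 * Real.exp (-Real.pi * (κ * τ.im * j ^ 2 - 2 * (|(A (z, τ)).im| + 1) * |j|))),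
    (summable_pow_mul_jacobiTheta₂_term_bound _ hT 0).mul_left _, ?_⟩
  filter_upwards [c1.continuousAt.eventually_lt_const (lt_add_one _),
    c2.continuousAt.eventually_lt_const (lt_add_one _),
    c3.continuousAt.eventually_const_lt hB] with p h1 h2 h3 j
  rw [key, norm_mul]
  have := norm_jacobiTheta₂_term_le hT h2.le h3.le j
  rw [pow_zero]
  simp only [one_mul]
  gcongr

/-- The heat equation for the level-κ theta functions:
`2πiκ ∂θ_{κ,n}/∂τ (λ,τ) = ∂²θ_{κ,n}/∂λ² (λ,τ)` for all `λ ∈ ℂ`, `τ ∈ ℍ`. -/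
theorem thetaKN_heat (κ : ℕ) (hκ : 0 < κ) (n : ℤ) (z τ : ℂ) (hτ : 0 < τ.im) :
    2 * cπ * I * (κ : ℂ) * deriv (fun t => ThetaKN κ n z t) τ =
      iteratedDeriv 2 (fun w => ThetaKN κ n w τ) z := by
  obtain ⟨u, hu, hb⟩ := theta_bound_aux κ hκ n z τ hτ
  have b1 : Filter.Tendsto (fun w : ℂ => (w, τ)) (nhds z) (nhds (z, τ)) :=
    (by fun_prop : Continuous fun w : ℂ => (w, τ)).continuousAt
  have b2 : Filter.Tendsto (fun t : ℂ => (z, t)) (nhds τ) (nhds (z, τ)) :=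
    (by fun_prop : Continuous fun t : ℂ => (z, t)).continuousAt
  have H1 := (hasSum_derivs_aux hu (fun j => by fun_prop) (b1.eventually hb)).2
  have H2 := (hasSum_derivs_aux hu (fun j => by fun_prop) (b2.eventually hb)).1
  have d1 : ∀ a b w : ℂ, HasDerivAt (fun w => exp (a + b * w)) (b * exp (a + b * w)) w := by
    intro a b w
    have := (((hasDerivAt_id w).const_mul b).const_add a).cexp
    simpa [mul_comm] using this
  have d2 : ∀ a b w : ℂ, HasDerivAt (fun w => exp (b * w + a)) (b * exp (b * w + a)) w := by
    intro a b w
    simpa only [add_comm] using d1 a b w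
  have d3 : ∀ a b : ℂ, deriv (fun w => exp (a + b * w)) = fun w => b * exp (a + b * w) :=
    fun a b => funext fun w => (d1 a b w).deriv
  have d4 : ∀ a b w : ℂ, deriv (fun w => b * exp (a + b * w)) w = b * (b * exp (a + b * w)) :=
    fun a b w => ((d1 a b w).const_mul b).deriv
  simp only [d3, d4] at H1
  simp only [(d2 _ _ _).deriv] at H2
  rw [iteratedDeriv_succ, iteratedDeriv_one]
  unfold ThetaKN
  refine (H2.mul_left (2 * cπ * I * (κ : ℂ))).unique ?_
  refine (congrArg (fun g => HasSum g _) (funext fun j => ?_)).mp H1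
  ring
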